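/- arXiv:1402.6059 — 5 statements merged into one kernel-verified Lean document; each statement's English description precedes it below -/
import Mathlib

section
/- For every real number α with 0 ≤ α < 1, there exists a sequence (m_n)_{n ≥ 2} of natural numbers such that for every n ≥ 2 one has 0 < m_n < n and gcd(m_n, n) = 1, and m_n / n → α as n → ∞. -/
open Filter Topology

/-- A finite set of `k` positive integers has product at least `k!`. -/
theorem factorial_card_le_prod_of_pos (s : Finset ℕ) (hs : ∀ x ∈ s, 0 < x) :
    s.card.factorial ≤ ∏ x ∈ s, x := by
  induction s using Finset.induction_on_max with
  | empty => simp
  | insert a s hlt ih =>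
    have ha : a ∉ s := fun h => lt_irrefl _ (hlt a h)
    have hpos : ∀ x ∈ s, 0 < x := fun x hx => hs x (Finset.mem_insert_of_mem hx)
    have hsub : s ⊆ Finset.Ico 1 a := fun x hx => Finset.mem_Ico.2 ⟨hpos x hx, hlt x hx⟩
    have hcard := Finset.card_le_card hsub
    have ha0 := hs a (Finset.mem_insert_self a s)
    rw [Nat.card_Ico] at hcard
    rw [Finset.card_insert_of_notMem ha, Finset.prod_insert ha, Nat.factorial_succ]
    exact Nat.mul_le_mul (by omega) (ih hpos)

theorem factorial_card_primeFactors_le {n : ℕ} (hn : 0 < n) :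
    n.primeFactors.card.factorial ≤ n :=
  (factorial_card_le_prod_of_pos _ fun _ hp => Nat.pos_of_mem_primeFactors hp).trans
    (Nat.le_of_dvd hn (Nat.prod_primeFactors_dvd n))

/-- Among `k + 1` consecutive integers `j`, where `k` is the number of prime factors of `n`,
some `1 + j * (k + 1)#` is coprime to `n`. -/
theorem exists_coprime_one_add_mul_primorial {n : ℕ} (hn : 0 < n) (b : ℕ) :
    ∃ i ≤ n.primeFactors.card,
      Nat.Coprime (1 + (b + i) * primorial (n.primeFactors.card + 1)) n := by
  set k := n.primeFactors.card
  set P := primorial (k + 1)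
  by_contra! hcon
  have hprime : ∀ i ∈ Finset.range (k + 1),
      ∃ p ∈ n.primeFactors, p ∣ 1 + (b + i) * P := by
    intro i hi
    obtain ⟨p, hp, h1, h2⟩ :=
      Nat.Prime.not_coprime_iff_dvd.1 (hcon i (Finset.mem_range_succ_iff.1 hi))
    exact ⟨p, Nat.mem_primeFactors.2 ⟨hp, h2, hn.ne'⟩, h1⟩
  choose! f hf hdvd using hprime
  obtain ⟨i, hi, j, hj, hij, hfij⟩ :=
    Finset.exists_ne_map_eq_of_card_lt_of_maps_to (t := n.primeFactors)
      (by rw [Finset.card_range]; omega) hf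
  have hp : (f i).Prime := Nat.prime_of_mem_primeFactors (hf i hi)
  have hpi := hdvd i hi
  have hpj := hdvd j hj
  rw [← hfij] at hpj
  have hnP : ¬ f i ∣ P := fun h =>
    hp.one_lt.ne' (Nat.dvd_one.1 ((Nat.dvd_add_left (h.mul_left _)).1 hpi))
  have hlarge : k + 1 < f i := by
    by_contra! hle
    exact hnP (hp.dvd_primorial_iff.2 hle)
  have hcop : IsCoprime (f i : ℤ) (P : ℤ) :=
    Nat.isCoprime_iff_coprime.2 ((Nat.Prime.coprime_iff_not_dvd hp).2 hnP)
  have hdiff : (f i : ℤ) ∣ ((i : ℤ) - j) := by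
    refine hcop.dvd_of_dvd_mul_right ?_
    have h := dvd_sub (Int.natCast_dvd_natCast.2 hpi) (Int.natCast_dvd_natCast.2 hpj)
    push_cast at h
    convert h using 1
    ring
  rw [Finset.mem_range] at hi hj
  have hzero := Int.eq_zero_of_abs_lt_dvd hdiff (by rw [abs_lt]; omega)
  omega

theorem exists_coprime_gt_le_add {n : ℕ} (hn : 0 < n) (a : ℕ) :
    ∃ m, a < m ∧ m ≤ a + 5 * 8 ^ n.primeFactors.card ∧ Nat.Coprime m n := by
  obtain ⟨i, hi, hcop⟩ :=
    exists_coprime_one_add_mul_primorial hn (a / primorial (n.primeFactors.card + 1) + 1)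
  set k := n.primeFactors.card
  have hPle : primorial (k + 1) ≤ 4 ^ (k + 1) := primorial_le_four_pow _
  set P := primorial (k + 1)
  have hP0 : 0 < P := primorial_pos _
  have hdiv := Nat.div_add_mod a P
  have hmod := Nat.mod_lt a hP0
  have hk2 : k + 1 ≤ 2 ^ k := Nat.lt_two_pow_self
  have hgap : (k + 1) * P ≤ 4 * 8 ^ k := by
    calc (k + 1) * P ≤ 2 ^ k * 4 ^ (k + 1) := Nat.mul_le_mul hk2 hPle
      _ = 4 * 8 ^ k := by rw [pow_succ, show (8 : ℕ) = 2 * 4 from rfl, mul_pow]; ring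
  have h8 : 1 ≤ 8 ^ k := Nat.one_le_pow _ _ (by norm_num)
  refine ⟨_, ?_, ?_, hcop⟩
  · nlinarith [Nat.zero_le (i * P)]
  · have hiP : i * P ≤ k * P := Nat.mul_le_mul_right P hi
    have hq := Nat.div_mul_le_self a P
    rw [add_mul] at hgap
    rw [add_mul, add_mul]
    omega

theorem tendsto_eight_pow_card_primeFactors_div :
    Tendsto (fun n : ℕ => (8 : ℝ) ^ n.primeFactors.card / n) atTop (𝓝 0) := by
  have hlim : Tendsto (fun n : ℕ => √(Real.exp 64) / √(n : ℝ)) atTop (𝓝 0) :=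
    tendsto_const_nhds.div_atTop (Real.tendsto_sqrt_atTop.comp tendsto_natCast_atTop_atTop)
  refine squeeze_zero' (Eventually.of_forall fun n => by positivity) ?_ hlim
  filter_upwards [eventually_gt_atTop 0] with n hn
  have hn' : (0 : ℝ) < n := Nat.cast_pos.2 hn
  have hfac : (n.primeFactors.card.factorial : ℝ) ≤ n := by
    exact_mod_cast factorial_card_primeFactors_le hn
  have hexp := Real.pow_div_factorial_le_exp 64 (by norm_num) n.primeFactors.card
  rw [div_le_iff₀ (by positivity)] at hexp
  have hsq : ((8 : ℝ) ^ n.primeFactors.card) ^ 2 ≤ Real.exp 64 * n := by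
    rw [← pow_mul, mul_comm, pow_mul]
    norm_num
    exact hexp.trans (by gcongr)
  have hle := Real.le_sqrt_of_sq_le hsq
  rw [Real.sqrt_mul (Real.exp_pos _).le] at hle
  rw [div_le_div_iff₀ hn' (Real.sqrt_pos.2 hn')]
  calc (8 : ℝ) ^ n.primeFactors.card * √n ≤ √(Real.exp 64) * √n * √n := by gcongr
    _ = √(Real.exp 64) * n := by rw [mul_assoc, Real.mul_self_sqrt hn'.le]

/-- For every real `α` with `0 ≤ α < 1`, there is a sequence `(m_n)` of
natural numbers such that for every `n ≥ 2` one has `0 < m_n < n` and `gcd(m_n, n) = 1`,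
and `m_n / n → α` as `n → ∞`. -/
theorem stmt_1 (α : ℝ) (h0 : 0 ≤ α) (h1 : α < 1) :
    ∃ m : ℕ → ℕ,
      (∀ n : ℕ, 2 ≤ n → 0 < m n ∧ m n < n ∧ Nat.gcd (m n) n = 1) ∧
      Tendsto (fun n : ℕ => (m n : ℝ) / (n : ℝ)) atTop (𝓝 α) := by
  have hex : ∀ n : ℕ, 0 < n → ∃ m, ⌊α * n⌋₊ < m ∧
      m ≤ ⌊α * n⌋₊ + 5 * 8 ^ n.primeFactors.card ∧ Nat.Coprime m n :=
    fun n hn => exists_coprime_gt_le_add hn _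
  choose! g hlow hupp hcop using hex
  have hlim : Tendsto (fun n : ℕ => (g n : ℝ) / n) atTop (𝓝 α) := by
    have hlim' : Tendsto (fun n : ℕ => α + 5 * ((8 : ℝ) ^ n.primeFactors.card / n))
        atTop (𝓝 α) := by
      simpa using (tendsto_eight_pow_card_primeFactors_div.const_mul 5).const_add α
    refine tendsto_of_tendsto_of_tendsto_of_le_of_le' tendsto_const_nhds hlim' ?_ ?_
    · filter_upwards [eventually_gt_atTop 0] with n hn
      rw [le_div_iff₀ (Nat.cast_pos.2 hn)]
      exact (Nat.lt_of_floor_lt (hlow n hn)).le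
    · filter_upwards [eventually_gt_atTop 0] with n hn
      have hn' : (0 : ℝ) < n := Nat.cast_pos.2 hn
      have hfloor := Nat.floor_le (mul_nonneg h0 hn'.le)
      have hle : (g n : ℝ) ≤ ⌊α * n⌋₊ + 5 * 8 ^ n.primeFactors.card := by
        exact_mod_cast hupp n hn
      rw [div_le_iff₀ hn', add_mul, mul_assoc, div_mul_cancel₀ _ hn'.ne']
      linarith
  refine ⟨fun n => if g n < n then g n else 1, fun n hn => ?_, hlim.congr' ?_⟩
  · have hn0 : 0 < n := by omega
    dsimp only
    split_ifs with h
    · exact ⟨(Nat.zero_le _).trans_lt (hlow n hn0), h, hcop n hn0⟩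
    · exact ⟨one_pos, hn, Nat.gcd_one_left n⟩
  · filter_upwards [hlim.eventually_lt_const h1, eventually_gt_atTop 0] with n hlt hn
    rw [div_lt_one (Nat.cast_pos.2 hn), Nat.cast_lt] at hlt
    rw [if_pos hlt]
end

section
/- Let V be an n-dimensional complex vector space, let f : V → V be a linear endomorphism, and let 0 ≤ l ≤ n. Then the multiset of roots of the characteristic polynomial of the induced endomorphism Λ^l f of the l-th exterior power Λ^l V equals the multiset of all products of the l-element sub-multisets of the multiset of roots of the characteristic polynomial of f; in other words, the eigenvalues of Λ^l f, with algebraic multiplicity, are exactly the products ∏_{i ∈ I} λ_i over l-element subsets I of the eigenvalues λ_1, …, λ_n of f counted with multiplicity. -/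
/-- The `l`-th exterior power `⋀[ℂ]^l V` of a finite-dimensional complex vector space is
finite-dimensional. -/
instance exteriorPower_finite (V : Type) [AddCommGroup V] [Module ℂ V]
    [Module.Finite ℂ V] (l : ℕ) : Module.Finite ℂ (⋀[ℂ]^l V) :=
  Module.Finite.iff_fg.mpr <|
    Submodule.FG.pow (Module.Finite.iff_fg.mp inferInstance) l

/-- The endomorphism `Λ^l f` of the `l`-th exterior power `⋀[ℂ]^l V` induced by a linear
endomorphism `f` of `V`, determined by `Λ^l f (v₁ ∧ ⋯ ∧ v_l) = f v₁ ∧ ⋯ ∧ f v_l`. -/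
noncomputable def extPowerMap {V : Type} [AddCommGroup V] [Module ℂ V] (l : ℕ)
    (f : V →ₗ[ℂ] V) : ⋀[ℂ]^l V →ₗ[ℂ] ⋀[ℂ]^l V :=
  (ExteriorAlgebra.map f).toLinearMap.restrict (p := ⋀[ℂ]^l V) (q := ⋀[ℂ]^l V)
    (fun x hx => by
      have key : Submodule.map (ExteriorAlgebra.map f).toLinearMap (⋀[ℂ]^l V)
          ≤ ⋀[ℂ]^l V := by
        rw [ExteriorAlgebra.exteriorPower, Submodule.map_pow]
        refine pow_le_pow_left' ?_ l
        rw [ExteriorAlgebra.ι_range_map_map]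
        exact LinearMap.map_le_range
      exact key ⟨x, hx, rfl⟩)

open Module Polynomial

/-- Every endomorphism of a finite-dimensional space over an algebraically closed field is
triangularizable: some basis has initial segments spanning invariant subspaces. -/
theorem exists_basis_map_mem_span_image_Iic {K : Type*} [Field K] [IsAlgClosed K] (n : ℕ) :
    ∀ {V : Type*} [AddCommGroup V] [Module K V] [FiniteDimensional K V],
      finrank K V = n → ∀ f : V →ₗ[K] V,
        ∃ b : Basis (Fin n) K V, ∀ i, f (b i) ∈ Submodule.span K (b '' Set.Iic i) := by
  induction n with
  | zero =>
    intro V _ _ _ hn f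
    exact ⟨finBasisOfFinrankEq K V hn, fun i => i.elim0⟩
  | succ n ih =>
    intro V _ _ _ hn f
    have : Nontrivial V := nontrivial_of_finrank_pos (R := K) (by omega)
    obtain ⟨μ, hμ⟩ := Module.End.exists_eigenvalue f
    have hlt : LinearMap.range (f - algebraMap K (Module.End K V) μ) < ⊤ := by
      rw [lt_top_iff_ne_top, Ne, ← LinearMap.ker_eq_bot_iff_range_eq_top]
      obtain ⟨v, hv⟩ := hμ.exists_hasEigenvector
      exact fun h => hv.2 (LinearMap.ker_eq_bot'.1 h v (by simp [hv.apply_eq_smul]))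
    obtain ⟨φ, hφ, hle⟩ := Submodule.exists_le_ker_of_lt_top _ hlt
    obtain ⟨y, hy⟩ := LinearMap.surjective hφ 1
    have hφf : ∀ z, φ (f z) = μ * φ z := fun z => by
      have : φ ((f - algebraMap K (Module.End K V) μ) z) = 0 := hle ⟨z, rfl⟩
      simpa [sub_eq_zero] using this
    have hinv : ∀ z ∈ LinearMap.ker φ, f z ∈ LinearMap.ker φ := fun z hz => by
      simp_all [LinearMap.mem_ker]
    have hfin : finrank K (LinearMap.ker φ) = n := by
      have h := LinearMap.finrank_range_add_finrank_ker φ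
      rw [LinearMap.range_eq_top.2 (LinearMap.surjective hφ), finrank_top, finrank_self] at h
      omega
    obtain ⟨b, hb⟩ := ih hfin (f.restrict hinv)
    let B : Basis (Fin (n + 1)) K V := Basis.mkFinSnoc b y
      (fun c x hx h => by simpa [hy, LinearMap.mem_ker.1 hx] using congrArg φ h)
      (fun z => ⟨-φ z, by simp [LinearMap.mem_ker, hy]⟩)
    have hB : ⇑B = Fin.snoc ((↑) ∘ b) y := Basis.coe_mkFinSnoc _ _ _ _
    have hBi : ∀ i : Fin n, B i.castSucc = b i := fun i => by simp [hB]
    refine ⟨B, fun i => ?_⟩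
    induction i using Fin.lastCases with
    | last =>
      have : Set.Iic (Fin.last n) = Set.univ := Set.eq_univ_of_forall Fin.le_last
      simp [this, B.span_eq]
    | cast i =>
      have h := Submodule.mem_map_of_mem (f := (LinearMap.ker φ).subtype) (hb i)
      rw [Submodule.map_span] at h
      rw [hBi]
      refine Submodule.span_mono ?_ h
      rintro _ ⟨_, ⟨j, hj, rfl⟩, rfl⟩
      exact ⟨j.castSucc, Fin.castSucc_le_castSucc_iff.2 hj, hBi j⟩

theorem exists_basis_toMatrix_isUpperTriangular {K V : Type*} [Field K] [IsAlgClosed K]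
    [AddCommGroup V] [Module K V] [FiniteDimensional K V] {n : ℕ} (hn : finrank K V = n)
    (f : V →ₗ[K] V) :
    ∃ b : Basis (Fin n) K V, (LinearMap.toMatrix b b f).IsUpperTriangular := by
  obtain ⟨b, hb⟩ := exists_basis_map_mem_span_image_Iic n hn f
  refine ⟨b, fun i j hij => ?_⟩
  rw [LinearMap.toMatrix_apply]
  by_contra h
  exact absurd ((b.mem_span_image.1 (hb j)) (Finsupp.mem_support_iff.2 h)) (not_le.2 hij)

theorem Matrix.BlockTriangular.charpoly_of_injective {R m α : Type*} [CommRing R] [Fintype m]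
    [DecidableEq m] [LinearOrder α] {M : Matrix m m R} {b : m → α} (h : M.BlockTriangular b)
    (hb : Function.Injective b) : M.charpoly = ∏ i, (X - C (M i i)) := by
  let _ := LinearOrder.lift' b hb
  convert charpoly_of_isUpperTriangular M (fun i j hij => h hij)

/-- A nonzero minor of an upper triangular matrix has its row indices below its column indices,
after sorting; only the sum of the indices is recorded. -/
theorem Matrix.IsUpperTriangular.eq_or_sum_lt_of_det_submatrix_ne_zero {R : Type*} [CommRing R]
    {n l : ℕ} {A : Matrix (Fin n) (Fin n) R} (hA : A.IsUpperTriangular) {s t : Fin l ↪o Fin n}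
    (h : (A.submatrix s t).det ≠ 0) :
    s = t ∨ ∑ i, (s i : ℕ) < ∑ i, (t i : ℕ) := by
  rw [det_apply] at h
  obtain ⟨σ, -, hσ⟩ := Finset.exists_ne_zero_of_sum_ne_zero h
  have hle : ∀ i, s (σ i) ≤ t i := fun i => by
    by_contra! hi
    exact hσ (by rw [Finset.prod_eq_zero (Finset.mem_univ i) (hA hi), smul_zero])
  rw [← Equiv.sum_comp σ]
  refine or_iff_not_imp_right.2 fun hlt => ?_
  have heq := (Finset.sum_eq_sum_iff_of_le (s := Finset.univ)
    (f := fun i => (s (σ i) : ℕ)) (g := fun i => (t i : ℕ)) fun i _ => hle i).1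
    (le_antisymm (Finset.sum_le_sum fun i _ => hle i) (not_lt.1 hlt))
  have hst : s ∘ σ = t := funext fun i => Fin.ext (heq i (Finset.mem_univ i))
  refine DFunLike.coe_injective ((s.strictMono.range_inj t.strictMono).1 ?_)
  rw [← hst, σ.surjective.range_comp]

theorem Matrix.IsUpperTriangular.det_submatrix_orderEmbedding {R : Type*} [CommRing R]
    {n l : ℕ} {A : Matrix (Fin n) (Fin n) R} (hA : A.IsUpperTriangular) (s : Fin l ↪o Fin n) :
    (A.submatrix s s).det = ∏ i, A (s i) (s i) :=
  det_of_isUpperTriangular fun _ _ hij => hA (s.strictMono hij)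

theorem extPowerMap_ιMulti {V : Type} [AddCommGroup V] [Module ℂ V] (l : ℕ) (f : V →ₗ[ℂ] V)
    (v : Fin l → V) :
    extPowerMap l f (exteriorPower.ιMulti ℂ l v) = exteriorPower.ιMulti ℂ l (f ∘ v) := by
  ext
  exact ExteriorAlgebra.map_apply_ιMulti f v

/-- The matrix of `Λ^l f` is the `l`-th compound matrix of the matrix of `f`. -/
theorem toMatrix_extPowerMap_apply {V : Type} [AddCommGroup V] [Module ℂ V] {n l : ℕ}
    (b : Basis (Fin n) ℂ V) (f : V →ₗ[ℂ] V) (s t : Set.powersetCard (Fin n) l) :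
    LinearMap.toMatrix (b.exteriorPower l) (b.exteriorPower l) (extPowerMap l f) s t =
      ((LinearMap.toMatrix b b f).submatrix (Set.powersetCard.ofFinEmbEquiv.symm s)
        (Set.powersetCard.ofFinEmbEquiv.symm t)).det := by
  rw [LinearMap.toMatrix_apply, exteriorPower.basis_apply, exteriorPower.ιMulti_family,
    extPowerMap_ιMulti, exteriorPower.basis_repr_apply, exteriorPower.ιMultiDual_apply_ιMulti,
    ← Matrix.det_transpose]
  congr 1
  ext i j
  simp [LinearMap.toMatrix_apply]

theorem prod_ofFinEmbEquiv_symm {M : Type*} [CommMonoid M] {n l : ℕ} (d : Fin n → M)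
    (s : Set.powersetCard (Fin n) l) :
    ∏ i, d (Set.powersetCard.ofFinEmbEquiv.symm s i) = ∏ x ∈ s.val, d x := by
  conv_rhs => rw [← Finset.map_orderEmbOfFin_univ s.val s.prop, Finset.prod_map]
  rfl

theorem charpoly_extPowerMap_of_isUpperTriangular {V : Type} [AddCommGroup V] [Module ℂ V]
    [FiniteDimensional ℂ V] {n : ℕ} (l : ℕ) (b : Basis (Fin n) ℂ V) (f : V →ₗ[ℂ] V)
    (hA : (LinearMap.toMatrix b b f).IsUpperTriangular) :
    (extPowerMap l f).charpoly = ∏ s ∈ Finset.powersetCard l (Finset.univ : Finset (Fin n)),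
      (X - C (∏ x ∈ s, LinearMap.toMatrix b b f x x)) := by
  classical
  let g : Set.powersetCard (Fin n) l → ℕ ×ₗ Fin (Fintype.card (Set.powersetCard (Fin n) l)) :=
    fun s => toLex (∑ i, (Set.powersetCard.ofFinEmbEquiv.symm s i : ℕ), Fintype.equivFin _ s)
  have hg : Function.Injective g := fun s t h =>
    (Fintype.equivFin _).injective (congrArg Prod.snd (toLex.injective h))
  have htri : (LinearMap.toMatrix (b.exteriorPower l) (b.exteriorPower l)
      (extPowerMap l f)).BlockTriangular g := fun s t hts => by
    rw [toMatrix_extPowerMap_apply]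
    by_contra h
    rcases hA.eq_or_sum_lt_of_det_submatrix_ne_zero h with hst | hlt
    · exact hts.ne (congrArg g (Set.powersetCard.ofFinEmbEquiv.symm.injective hst)).symm
    · exact lt_asymm hts (Prod.Lex.toLex_lt_toLex.2 (Or.inl hlt))
  rw [← LinearMap.charpoly_toMatrix _ (b.exteriorPower l), htri.charpoly_of_injective hg]
  simp_rw [toMatrix_extPowerMap_apply, hA.det_submatrix_orderEmbedding,
    prod_ofFinEmbEquiv_symm (fun x => LinearMap.toMatrix b b f x x)]
  exact (Finset.prod_subtype (Finset.powersetCard l Finset.univ)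
    (fun s => by simp) fun s => X - C (∏ x ∈ s, LinearMap.toMatrix b b f x x)).symm

theorem roots_prod_X_sub_C_comp {R ι : Type*} [CommRing R] [IsDomain R] (s : Finset ι)
    (a : ι → R) : (∏ i ∈ s, (X - C (a i))).roots = s.val.map a := by
  rw [← Polynomial.roots_multiset_prod_X_sub_C (s.val.map a), Multiset.map_map]
  rfl

/-- Let `V` be an `n`-dimensional complex vector space, `f : V → V`
linear, `0 ≤ l ≤ n`.  The multiset of roots of the characteristic polynomial of `Λ^l f`
equals the multiset of products of the `l`-element sub-multisets of the multiset of roots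
of the characteristic polynomial of `f`. -/
theorem stmt_6 (n l : ℕ) (hl : l ≤ n) (V : Type) [AddCommGroup V] [Module ℂ V]
    [FiniteDimensional ℂ V] (hn : Module.finrank ℂ V = n) (f : V →ₗ[ℂ] V) :
    (extPowerMap l f).charpoly.roots
      = (f.charpoly.roots.powersetCard l).map Multiset.prod := by
  obtain ⟨b, hA⟩ := exists_basis_toMatrix_isUpperTriangular hn f
  rw [charpoly_extPowerMap_of_isUpperTriangular l b f hA, ← LinearMap.charpoly_toMatrix f b,
    Matrix.charpoly_of_isUpperTriangular _ hA, roots_prod_X_sub_C_comp, roots_prod_X_sub_C_comp,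
    Multiset.powersetCard_map, ← Finset.map_val_val_powersetCard, Multiset.map_map,
    Multiset.map_map]
  rfl
end

section
/- Let g ≥ 2 and 2 ≤ l ≤ g. If v_1, …, v_l ∈ ℂ^{2g} are linearly independent, then the decomposable element v_1 ∧ ⋯ ∧ v_l of Λ^l ℂ^{2g} does not lie in the subspace ω ∧ Λ^{l−2} ℂ^{2g}, i.e. there is no y ∈ Λ^{l−2} ℂ^{2g} with v_1 ∧ ⋯ ∧ v_l = ω ∧ y. -/
/-- The standard symplectic bivector `ω = ∑_{i=1}^{g} e_i ∧ e_{g+i}` in the exterior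
algebra of `ℂ^{2g}`, where `e_1, …, e_{2g}` is the standard basis. -/
noncomputable def omegaBivector (g : ℕ) : ExteriorAlgebra ℂ (Fin (2 * g) → ℂ) :=
  ∑ i : Fin g,
    ExteriorAlgebra.ι ℂ (Pi.single (⟨(i : ℕ), by omega⟩ : Fin (2 * g)) 1) *
      ExteriorAlgebra.ι ℂ (Pi.single (⟨g + (i : ℕ), by omega⟩ : Fin (2 * g)) 1)

open Module

/-- A submodule contained in neither of two submodules is not contained in their union. -/
theorem Submodule.exists_mem_notMem_notMem {R M : Type*} [Ring R] [AddCommGroup M] [Module R M]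
    {P A B : Submodule R M} (hA : ¬ P ≤ A) (hB : ¬ P ≤ B) : ∃ x ∈ P, x ∉ A ∧ x ∉ B := by
  obtain ⟨x, hxP, hxA⟩ := SetLike.not_le_iff_exists.1 hA
  obtain ⟨y, hyP, hyB⟩ := SetLike.not_le_iff_exists.1 hB
  by_cases hxB : x ∈ B
  · by_cases hyA : y ∈ A
    · exact ⟨x + y, P.add_mem hxP hyP, fun h => hxA ((A.add_mem_iff_left hyA).1 h),
        fun h => hyB ((B.add_mem_iff_right hxB).1 h)⟩
    · exact ⟨y, hyP, hyA, hyB⟩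
  · exact ⟨x, hxP, hxA, hxB⟩

theorem Submodule.disjoint_sup_span_singleton {K V : Type*} [Field K] [AddCommGroup V] [Module K V]
    {U N : Submodule K V} (h : Disjoint U N) {u : V} (hu : u ∉ U ⊔ N) :
    Disjoint (U ⊔ K ∙ u) N := by
  rw [sup_comm]
  exact h.disjoint_sup_left_of_disjoint_sup_right
    (Submodule.disjoint_span_singleton_of_notMem hu).symm

namespace LinearMap.BilinForm

variable {K V : Type*} [Field K] [AddCommGroup V] [Module K V] [FiniteDimensional K V]
  {B : LinearMap.BilinForm K V}

theorem orthogonal_not_le_sup (hB : B.Nondegenerate) (hr : B.IsRefl) {U N : Submodule K V}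
    (hd : Disjoint U (B.orthogonal N)) (hlt : finrank K U < finrank K (B.orthogonal N)) :
    ¬ B.orthogonal U ≤ U ⊔ N := by
  intro hle
  have hdis : Disjoint (B.orthogonal U) (B.orthogonal N) := by
    rw [Submodule.disjoint_def]
    intro x hxU hxN
    refine Submodule.disjoint_def.1 hd x ?_ hxN
    rw [← orthogonal_orthogonal hB hr U]
    intro y hy
    obtain ⟨a, ha, b, hb, rfl⟩ := Submodule.mem_sup.1 (hle hy)
    change B (a + b) x = 0
    rw [map_add, LinearMap.add_apply, hxU a ha, hxN b hb, add_zero]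
  have := Submodule.finrank_add_finrank_le_of_disjoint hdis
  have h := finrank_orthogonal hB U
  have := U.finrank_le
  omega

/-- In a symplectic space, a subspace `N` and its orthogonal both of dimension at least `k` admit
a common transverse isotropic subspace of dimension `k`. -/
theorem exists_isotropic_disjoint (hB : B.Nondegenerate) (ha : B.IsAlt) (N : Submodule K V)
    (k : ℕ) (hk : k ≤ finrank K N) (hk' : k ≤ finrank K (B.orthogonal N)) :
    ∃ U : Submodule K V, finrank K U = k ∧ U ≤ B.orthogonal U ∧
      Disjoint U N ∧ Disjoint U (B.orthogonal N) := by
  induction k with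
  | zero => exact ⟨⊥, by simp⟩
  | succ k ih =>
    obtain ⟨U, hUk, hU, hUN, hUN'⟩ := ih (by omega) (by omega)
    have hr := ha.isRefl
    have h₁ : ¬ B.orthogonal U ≤ U ⊔ N := orthogonal_not_le_sup hB hr hUN' (by omega)
    have h₂ : ¬ B.orthogonal U ≤ U ⊔ B.orthogonal N := by
      apply orthogonal_not_le_sup hB hr <;> rw [orthogonal_orthogonal hB hr]
      exacts [hUN, by omega]
    obtain ⟨u, hu, hu₁, hu₂⟩ := Submodule.exists_mem_notMem_notMem h₁ h₂
    refine ⟨U ⊔ K ∙ u, ?_, ?_, Submodule.disjoint_sup_span_singleton hUN hu₁,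
      Submodule.disjoint_sup_span_singleton hUN' hu₂⟩
    · rw [Submodule.finrank_sup_span_singleton fun h => hu₁ (Submodule.mem_sup_left h), hUk]
    · intro x hx y hy
      obtain ⟨a, haU, c, hc, rfl⟩ := Submodule.mem_sup.1 hx
      obtain ⟨b, hbU, d, hd, rfl⟩ := Submodule.mem_sup.1 hy
      obtain ⟨c, rfl⟩ := Submodule.mem_span_singleton.1 hc
      obtain ⟨d, rfl⟩ := Submodule.mem_span_singleton.1 hd
      have e₁ : B b a = 0 := hU haU b hbU
      have e₂ : B b u = 0 := hu b hbU
      have e₃ : B u a = 0 := hr _ _ (hu a haU)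
      simp [e₁, e₂, e₃, ha.self_eq_zero u]

end LinearMap.BilinForm

namespace ExteriorAlgebra

theorem ιMulti_ne_zero {K V : Type*} [Field K] [AddCommGroup V] [Module K V] {n : ℕ}
    (b : Basis (Fin n) K V) : ιMulti K n b ≠ 0 := by
  intro h
  have := liftAlternating_apply_ιMulti (R := K) (Pi.single n b.det) b
  rw [h, map_zero, Pi.single_eq_same, b.det_self] at this
  exact zero_ne_one this

/-- A bivector whose coefficient matrix is symmetric vanishes. -/
theorem sum_ι_mul_ι_eq_zero {R ι' κ : Type*} [CommRing R] [Fintype ι'] [Fintype κ]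
    (p q : ι' → κ → R) (h : ∀ a b, ∑ i, (p i a * q i b - p i b * q i a) = 0)
    (h₂ : IsUnit (2 : R)) :
    ∑ i, ι R (p i) * ι R (q i) = 0 := by
  classical
  let e : κ → ExteriorAlgebra R (κ → R) := fun a => ι R (Pi.single a 1)
  have hexp (x : κ → R) : ι R x = ∑ a, x a • e a := by
    conv_lhs => rw [pi_eq_sum_univ' x]
    simp [e]
  have hS : ∑ i, ι R (p i) * ι R (q i) = ∑ a, ∑ b, (∑ i, p i a * q i b) • (e a * e b) := by
    simp_rw [hexp, Finset.sum_mul_sum, Finset.sum_smul, smul_mul_smul_comm]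
    rw [Finset.sum_comm]
    exact Finset.sum_congr rfl fun a _ => Finset.sum_comm
  have hneg : ∑ a, ∑ b, (∑ i, p i a * q i b) • (e a * e b) =
      -∑ a, ∑ b, (∑ i, p i a * q i b) • (e a * e b) := by
    conv_lhs => rw [Finset.sum_comm]
    simp_rw [← Finset.sum_neg_distrib]
    refine Finset.sum_congr rfl fun a _ => Finset.sum_congr rfl fun b _ => ?_
    have hab := h a b
    rw [Finset.sum_sub_distrib, sub_eq_zero] at hab
    rw [hab, eq_neg_of_add_eq_zero_left (ι_add_mul_swap (R := R) (Pi.single b 1) (Pi.single a 1)),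
      smul_neg]
  rw [hS, ← h₂.smul_eq_zero, two_smul]
  exact add_eq_zero_iff_eq_neg.2 hneg

end ExteriorAlgebra

/-- The standard symplectic form on `ℂ^{2g}`. -/
noncomputable def stdSymplecticForm (g : ℕ) : LinearMap.BilinForm ℂ (Fin (2 * g) → ℂ) :=
  LinearMap.mk₂ ℂ
    (fun x y => ∑ i : Fin g,
      (x ⟨i, by omega⟩ * y ⟨g + i, by omega⟩ - x ⟨g + i, by omega⟩ * y ⟨i, by omega⟩))
    (fun x x' y => by
      rw [← Finset.sum_add_distrib]; exact Finset.sum_congr rfl fun i _ => by simp; ring)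
    (fun c x y => by
      rw [Finset.smul_sum]; exact Finset.sum_congr rfl fun i _ => by simp; ring)
    (fun x y y' => by
      rw [← Finset.sum_add_distrib]; exact Finset.sum_congr rfl fun i _ => by simp; ring)
    (fun c x y => by
      rw [Finset.smul_sum]; exact Finset.sum_congr rfl fun i _ => by simp; ring)

namespace stdSymplecticForm

variable {g : ℕ}

theorem apply (x y : Fin (2 * g) → ℂ) :
    stdSymplecticForm g x y = ∑ i : Fin g,
      (x ⟨i, by omega⟩ * y ⟨g + i, by omega⟩ - x ⟨g + i, by omega⟩ * y ⟨i, by omega⟩) := rfl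

theorem isAlt : (stdSymplecticForm g).IsAlt := fun x => by
  rw [apply]
  exact Finset.sum_eq_zero fun i _ => by ring

theorem apply_single_fst (x : Fin (2 * g) → ℂ) (i : Fin g) :
    stdSymplecticForm g x (Pi.single ⟨i, by omega⟩ 1) = -x ⟨g + i, by omega⟩ := by
  rw [apply, Finset.sum_eq_single i]
  · simp [i.pos.ne']
  · intro j _ hj
    have := Fin.val_ne_of_ne hj
    simp [Pi.single_apply, this]
    omega
  · simp

theorem apply_single_snd (x : Fin (2 * g) → ℂ) (i : Fin g) :
    stdSymplecticForm g x (Pi.single ⟨g + i, by omega⟩ 1) = x ⟨i, by omega⟩ := by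
  rw [apply, Finset.sum_eq_single i]
  · simp [i.pos.ne']
  · intro j _ hj
    have := Fin.val_ne_of_ne hj
    simp [Pi.single_apply, this]
    omega
  · simp

theorem nondegenerate : (stdSymplecticForm g).Nondegenerate := by
  have hl : (stdSymplecticForm g).SeparatingLeft := by
    intro x hx
    ext ⟨j, hj⟩
    by_cases h : j < g
    · rw [Pi.zero_apply, ← hx _, apply_single_snd x ⟨j, h⟩]
    · have := apply_single_fst x ⟨j - g, by omega⟩
      rw [hx, eq_comm, neg_eq_zero] at this
      simpa [show g + (j - g) = j by omega] using this
  exact ⟨hl, fun y hy => hl y fun x => isAlt.isRefl _ _ (hy x)⟩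

end stdSymplecticForm


/-- Let `g ≥ 2` and `2 ≤ l ≤ g`.  If `v_1, …, v_l ∈ ℂ^{2g}` are linearly
independent, then the decomposable element `v_1 ∧ ⋯ ∧ v_l` of `Λ^l ℂ^{2g}` does not lie
in the subspace `ω ∧ Λ^{l-2} ℂ^{2g}`: there is no `y ∈ Λ^{l-2} ℂ^{2g}` with
`v_1 ∧ ⋯ ∧ v_l = ω ∧ y`. -/
theorem stmt_8 (g l : ℕ) (hg : 2 ≤ g) (hl : 2 ≤ l) (hlg : l ≤ g)
    (v : Fin l → (Fin (2 * g) → ℂ)) (hv : LinearIndependent ℂ v) :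
    ¬ ∃ y ∈ ⋀[ℂ]^(l - 2) (Fin (2 * g) → ℂ),
        (ExteriorAlgebra.ιMulti ℂ l v : ExteriorAlgebra ℂ (Fin (2 * g) → ℂ))
          = omegaBivector g * y := by
  rintro ⟨y, -, h⟩
  set B := stdSymplecticForm g
  have hB : B.Nondegenerate := stdSymplecticForm.nondegenerate
  have hr : B.IsRefl := stdSymplecticForm.isAlt.isRefl
  set W := Submodule.span ℂ (Set.range v)
  have hW : finrank ℂ W = l := by simpa using finrank_span_eq_card hv
  have hW' : finrank ℂ (B.orthogonal W) = 2 * g - l := by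
    rw [LinearMap.BilinForm.finrank_orthogonal hB, hW]
    simp
  obtain ⟨U, hUl, hU, -, hUW⟩ := LinearMap.BilinForm.exists_isotropic_disjoint hB
    stdSymplecticForm.isAlt W l (by omega) (by omega)
  let u := finBasisOfFinrankEq ℂ U hUl
  let F : (Fin (2 * g) → ℂ) →ₗ[ℂ] (Fin l → ℂ) := LinearMap.pi fun a => B (u a)
  have hF (a b : Fin l) : B (u a) (u b) = 0 := hU (u b).2 _ (u a).2
  have htop : U ⊔ B.orthogonal W = ⊤ := by
    apply Submodule.eq_top_of_disjoint _ _ _ hUW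
    rw [hUl, hW']
    simp
    omega
  have hinj : Disjoint W (LinearMap.ker F) := by
    rw [Submodule.disjoint_def]
    intro x hxW hxF
    refine hB.2 x fun z => ?_
    obtain ⟨a, ha, b, hb, rfl⟩ := Submodule.mem_sup.1 (htop ▸ Submodule.mem_top : z ∈ _)
    have hU0 : U ≤ LinearMap.ker (B.flip x) := by
      have := congrArg (Submodule.map U.subtype) u.span_eq
      rw [Submodule.map_span, Submodule.map_top, Submodule.range_subtype] at this
      rw [← this, Submodule.span_le]
      rintro _ ⟨_, ⟨a, rfl⟩, rfl⟩
      exact congrFun hxF a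
    rw [map_add, LinearMap.add_apply, hr _ _ (hb x hxW), add_zero]
    exact hU0 ha
  have hw : LinearIndependent ℂ (F ∘ v) := hv.map hinj
  let b := basisOfLinearIndependentOfCardEqFinrank' _ hw (by simp)
  apply ExteriorAlgebra.ιMulti_ne_zero b
  have homega : ExteriorAlgebra.map F (omegaBivector g) = 0 := by
    simp only [omegaBivector, map_sum, map_mul, ExteriorAlgebra.map_apply_ι]
    refine ExteriorAlgebra.sum_ι_mul_ι_eq_zero _ _ (fun a b => ?_) (by simp)
    rw [← hF a b, stdSymplecticForm.apply]
    refine Finset.sum_congr rfl fun i _ => ?_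
    simp only [F, LinearMap.pi_apply, B, stdSymplecticForm.apply_single_fst,
      stdSymplecticForm.apply_single_snd]
    ring
  have := congrArg (ExteriorAlgebra.map F) h
  rw [map_mul, homega, zero_mul, ExteriorAlgebra.map_apply_ιMulti] at this
  simpa [b] using this
end

section
/- Let g ≥ 1 and 2 ≤ l ≤ g. Then the linear map Λ^{l−2} ℂ^{2g} → Λ^l ℂ^{2g} given by y ↦ ω ∧ y is injective. -/
namespace ExteriorAlgebra

section Contraction

variable {R M : Type*} [CommRing R] [AddCommGroup M] [Module R M]

/-- The interior product of an element of the exterior algebra with a linear form. -/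
noncomputable def interior (d : Module.Dual R M) : ExteriorAlgebra R M →ₗ[R] ExteriorAlgebra R M :=
  CliffordAlgebra.contractLeft (Q := (0 : QuadraticForm R M)) d

theorem interior_ι_mul (d : Module.Dual R M) (m : M) (x : ExteriorAlgebra R M) :
    interior d (ι R m * x) = d m • x - ι R m * interior d x :=
  CliffordAlgebra.contractLeft_ι_mul d m x

theorem interior_algebraMap (d : Module.Dual R M) (r : R) :
    interior d (algebraMap R (ExteriorAlgebra R M) r) = 0 :=
  CliffordAlgebra.contractLeft_algebraMap _ d r

theorem interior_eq_zero_of_mem_zero (d : Module.Dual R M) {x : ExteriorAlgebra R M}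
    (hx : x ∈ ⋀[R]^0 M) : interior d x = 0 := by
  rw [exteriorPower, pow_zero, Submodule.mem_one] at hx
  obtain ⟨r, rfl⟩ := hx
  exact interior_algebraMap d r

theorem interior_mem (d : Module.Dual R M) (k : ℕ) {x : ExteriorAlgebra R M}
    (hx : x ∈ ⋀[R]^(k + 1) M) : interior d x ∈ ⋀[R]^k M := by
  induction k generalizing x with
  | zero =>
    rw [exteriorPower, zero_add, pow_one] at hx
    obtain ⟨m, rfl⟩ := hx
    rw [← mul_one (ι R m), interior_ι_mul, ← map_one (algebraMap R _), interior_algebraMap,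
      mul_zero, sub_zero, exteriorPower, pow_zero]
    exact Submodule.smul_mem _ _ (Submodule.algebraMap_mem 1)
  | succ k ih =>
    rw [exteriorPower, pow_succ'] at hx
    induction hx using Submodule.mul_induction_on' with
    | mem_mul_mem v hv y hy =>
      obtain ⟨m, rfl⟩ := hv
      rw [interior_ι_mul]
      refine Submodule.sub_mem _ (Submodule.smul_mem _ _ hy) ?_
      rw [exteriorPower, pow_succ']
      exact Submodule.mul_mem_mul ⟨m, rfl⟩ (ih hy)
    | add y _ z _ hy hz =>
      rw [map_add]
      exact Submodule.add_mem _ hy hz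

/-- Euler's formula for the exterior algebra. -/
theorem sum_ι_mul_interior_coord {κ : Type*} [Fintype κ] (b : Module.Basis κ R M) (k : ℕ)
    {x : ExteriorAlgebra R M} (hx : x ∈ ⋀[R]^k M) :
    ∑ v, ι R (b v) * interior (b.coord v) x = (k : R) • x := by
  induction k generalizing x with
  | zero => simp [interior_eq_zero_of_mem_zero _ hx]
  | succ k ih =>
    rw [exteriorPower, pow_succ'] at hx
    induction hx using Submodule.mul_induction_on' with
    | mem_mul_mem v hv y hy =>
      obtain ⟨m, rfl⟩ := hv
      have hswap (v : κ) : ι R (b v) * (ι R m * interior (b.coord v) y) =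
          -(ι R m * (ι R (b v) * interior (b.coord v) y)) := by
        rw [← mul_assoc, ← mul_assoc, ← neg_mul, eq_neg_of_add_eq_zero_left (ι_add_mul_swap _ _)]
      have hsum : ∑ v, ι R (b v) * (b.coord v m • y) = ι R m * y := by
        conv_rhs => rw [← b.sum_repr m, map_sum, Finset.sum_mul]
        simp
      simp_rw [interior_ι_mul, mul_sub, hswap, sub_neg_eq_add]
      rw [Finset.sum_add_distrib, hsum, ← Finset.mul_sum, ih hy, Nat.cast_succ, add_smul, one_smul,
        mul_smul_comm, add_comm]
    | add y _ z _ hy hz =>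
      simp only [map_add, mul_add, Finset.sum_add_distrib, hy, hz, smul_add]

end Contraction

section Lefschetz

variable {K M κ : Type*} [Field K] [AddCommGroup M] [Module K M]

theorem interior_interior_ι_mul_ι_mul [DecidableEq κ] (b : Module.Basis (κ ⊕ κ) K M) (i j : κ)
    (x : ExteriorAlgebra K M) :
    interior (b.coord (.inr j)) (interior (b.coord (.inl j))
        (ι K (b (.inl i)) * (ι K (b (.inr i)) * x))) =
      ι K (b (.inl i)) * (ι K (b (.inr i)) *
        interior (b.coord (.inr j)) (interior (b.coord (.inl j)) x)) +
      if i = j then x - (ι K (b (.inl i)) * interior (b.coord (.inl i)) x +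
        ι K (b (.inr i)) * interior (b.coord (.inr i)) x) else 0 := by
  by_cases h : i = j
  · subst h
    simp [interior_ι_mul, mul_sub]
    abel
  · simp [interior_ι_mul, h]

variable [Fintype κ]

/-- The bivector `∑ i, p i ∧ q i` attached to a basis `(p, q)`. -/
noncomputable def bivector (b : Module.Basis (κ ⊕ κ) K M) : ExteriorAlgebra K M :=
  ∑ i, ι K (b (.inl i)) * ι K (b (.inr i))

/-- The interior product with the bivector dual to `bivector b`. -/
noncomputable def dualLefschetz (b : Module.Basis (κ ⊕ κ) K M) :
    ExteriorAlgebra K M →ₗ[K] ExteriorAlgebra K M :=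
  ∑ i, interior (b.coord (.inr i)) ∘ₗ interior (b.coord (.inl i))

theorem dualLefschetz_mem (b : Module.Basis (κ ⊕ κ) K M) (k : ℕ) {x : ExteriorAlgebra K M}
    (hx : x ∈ ⋀[K]^(k + 2) M) : dualLefschetz b x ∈ ⋀[K]^k M := by
  rw [dualLefschetz, LinearMap.sum_apply]
  exact Submodule.sum_mem _ fun i _ => interior_mem _ _ (interior_mem _ _ hx)

theorem dualLefschetz_eq_zero (b : Module.Basis (κ ⊕ κ) K M) {k : ℕ} (hk : k < 2)
    {x : ExteriorAlgebra K M} (hx : x ∈ ⋀[K]^k M) : dualLefschetz b x = 0 := by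
  rw [dualLefschetz, LinearMap.sum_apply]
  refine Finset.sum_eq_zero fun i _ => ?_
  rw [LinearMap.comp_apply]
  interval_cases k
  · rw [interior_eq_zero_of_mem_zero _ hx, map_zero]
  · exact interior_eq_zero_of_mem_zero _ (interior_mem _ _ hx)

/-- The commutation relation of the Lefschetz operator with its dual. -/
theorem dualLefschetz_bivector_mul (b : Module.Basis (κ ⊕ κ) K M) (k : ℕ)
    {x : ExteriorAlgebra K M} (hx : x ∈ ⋀[K]^k M) :
    dualLefschetz b (bivector b * x) =
      bivector b * dualLefschetz b x + ((Fintype.card κ : K) - k) • x := by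
  classical
  have euler := sum_ι_mul_interior_coord b k hx
  rw [Fintype.sum_sum_type, ← Finset.sum_add_distrib] at euler
  simp only [dualLefschetz, bivector, LinearMap.sum_apply, LinearMap.comp_apply, Finset.sum_mul,
    Finset.mul_sum, map_sum, mul_assoc, interior_interior_ι_mul_ι_mul, Finset.sum_add_distrib]
  congr 1
  · exact Finset.sum_comm
  · simp only [Finset.sum_ite_eq, Finset.mem_univ, if_true, Finset.sum_sub_distrib, euler]
    simp [sub_smul, Nat.cast_smul_eq_nsmul]

theorem eq_zero_of_bivector_mul_dualLefschetz [CharZero K] (b : Module.Basis (κ ⊕ κ) K M)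
    (k a : ℕ) (hk : k ≤ Fintype.card κ) (ha : a ≠ 0) {x : ExteriorAlgebra K M}
    (hx : x ∈ ⋀[K]^k M) (h : bivector b * dualLefschetz b x = -((a : K) • x)) : x = 0 := by
  suffices hz : dualLefschetz b x = 0 by
    rw [hz, mul_zero, eq_comm, neg_eq_zero, smul_eq_zero] at h
    exact h.resolve_left (Nat.cast_ne_zero.2 ha)
  induction k using Nat.strong_induction_on generalizing a x with
  | _ k ih =>
    obtain hk2 | hk2 := lt_or_ge k 2
    · exact dualLefschetz_eq_zero b hk2 hx
    obtain ⟨k, rfl⟩ := Nat.exists_eq_add_of_le' hk2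
    have hy := dualLefschetz_mem b k hx
    have hcomm := dualLefschetz_bivector_mul b k hy
    rw [h, map_neg, map_smul] at hcomm
    have ha' : a + (Fintype.card κ - k) ≠ 0 := by omega
    have h' : bivector b * dualLefschetz b (dualLefschetz b x) =
        -(((a + (Fintype.card κ - k) : ℕ) : K) • dualLefschetz b x) := by
      rw [Nat.cast_add, Nat.cast_sub (by omega), add_smul, neg_add, hcomm]
      abel
    have hz := ih k (by omega) _ (by omega) ha' hy h'
    rw [hz, mul_zero, eq_comm, neg_eq_zero, smul_eq_zero] at h'
    exact h'.resolve_left (Nat.cast_ne_zero.2 ha')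

/-- The Lefschetz operator is injective below the middle degree. -/
theorem eq_zero_of_bivector_mul_eq_zero [CharZero K] (b : Module.Basis (κ ⊕ κ) K M) {k : ℕ}
    (hk : k < Fintype.card κ) {x : ExteriorAlgebra K M} (hx : x ∈ ⋀[K]^k M)
    (h : bivector b * x = 0) : x = 0 := by
  refine eq_zero_of_bivector_mul_dualLefschetz b k (Fintype.card κ - k) hk.le (by omega) hx ?_
  have hcomm := dualLefschetz_bivector_mul b k hx
  rw [h, map_zero] at hcomm
  rw [Nat.cast_sub hk.le]
  exact eq_neg_of_add_eq_zero_left hcomm.symm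

end Lefschetz

end ExteriorAlgebra

theorem omegaBivector_eq_bivector (g : ℕ) :
    omegaBivector g = ExteriorAlgebra.bivector ((Pi.basisFun ℂ (Fin (2 * g))).reindex
      ((finCongr (two_mul g)).trans finSumFinEquiv.symm)) := by
  simp only [omegaBivector, ExteriorAlgebra.bivector, Module.Basis.reindex_apply,
    Pi.basisFun_apply]
  rfl

/-- Let `g ≥ 1` and `2 ≤ l ≤ g`.  The linear map
`Λ^{l-2} ℂ^{2g} → Λ^l ℂ^{2g}` given by `y ↦ ω ∧ y` is injective. -/
theorem stmt_9 (g l : ℕ) (hg : 1 ≤ g) (hl : 2 ≤ l) (hlg : l ≤ g) :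
    Function.Injective
      (fun y : ⋀[ℂ]^(l - 2) (Fin (2 * g) → ℂ) =>
        omegaBivector g * (y : ExteriorAlgebra ℂ (Fin (2 * g) → ℂ))) := by
  intro y z hyz
  rw [omegaBivector_eq_bivector] at hyz
  refine Subtype.ext (sub_eq_zero.1 ?_)
  refine ExteriorAlgebra.eq_zero_of_bivector_mul_eq_zero
    ((Pi.basisFun ℂ (Fin (2 * g))).reindex ((finCongr (two_mul g)).trans finSumFinEquiv.symm))
    (by rw [Fintype.card_fin]; omega) (Submodule.sub_mem _ y.2 z.2) ?_
  rw [mul_sub, sub_eq_zero]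
  exact hyz
end

section
/- Let g ≥ 1 and 2 ≤ l ≤ g. Then the quotient space Λ^l ℂ^{2g} / (ω ∧ Λ^{l−2} ℂ^{2g}) has complex dimension (2g choose l) − (2g choose l−2). -/
/-- The subspace `ω ∧ Λ^{l-2} ℂ^{2g}` of `Λ^l ℂ^{2g}`: the image of the map
`y ↦ ω ∧ y`, viewed as a subspace of `Λ^l ℂ^{2g}`. -/
noncomputable def omegaWedgeSubspace (g l : ℕ) :
    Submodule ℂ (⋀[ℂ]^l (Fin (2 * g) → ℂ)) :=
  Submodule.comap (⋀[ℂ]^l (Fin (2 * g) → ℂ)).subtype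
    (Submodule.map (LinearMap.mulLeft ℂ (omegaBivector g))
      (⋀[ℂ]^(l - 2) (Fin (2 * g) → ℂ)))

section CanonicalAnticommutation

variable {R : Type*} [Ring R]

/-- The commutator of a product of two creation operators with the product of the corresponding
annihilation operators. -/
lemma mul_sub_mul_of_anticommute {a b A B : R} (hAa : A * a = 1 - a * A) (hBb : B * b = 1 - b * B)
    (hAb : A * b = -(b * A)) (hBa : B * a = -(a * B)) :
    a * b * (B * A) - B * A * (a * b) = a * A + b * B - 1 := by
  have key : B * A * (a * b) = 1 - b * B - a * A + a * b * (B * A) := by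
    calc B * A * (a * b) = B * (A * a) * b := by noncomm_ring
      _ = B * b - (B * a) * (A * b) := by rw [hAa]; noncomm_ring
      _ = B * b - a * (B * b) * A := by rw [hBa, hAb]; noncomm_ring
      _ = _ := by rw [hBb]; noncomm_ring
  rw [key]
  abel

/-- Products of two pairwise anticommuting elements commute. -/
lemma mul_sub_mul_eq_zero_of_anticommute {a b A B : R} (hAa : A * a = -(a * A))
    (hBb : B * b = -(b * B)) (hAb : A * b = -(b * A)) (hBa : B * a = -(a * B)) :
    a * b * (B * A) - B * A * (a * b) = 0 := by
  have key : B * A * (a * b) = a * b * (B * A) := by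
    calc B * A * (a * b) = B * (A * a) * b := by noncomm_ring
      _ = -((B * a) * (A * b)) := by rw [hAa]; noncomm_ring
      _ = -(a * (B * b) * A) := by rw [hBa, hAb]; noncomm_ring
      _ = _ := by rw [hBb]; noncomm_ring
  rw [key, sub_self]

variable {n : Type*} [Fintype n] [DecidableEq n]

/-- The canonical anticommutation relations between creation operators `a` and annihilation
operators `A`. -/
structure IsFermionic (a A : n → R) : Prop where
  creation_mul_creation (i j : n) : a i * a j = -(a j * a i)
  annihilation_mul_annihilation (i j : n) : A i * A j = -(A j * A i)
  annihilation_mul_creation (i j : n) : A i * a j = (if i = j then 1 else 0) - a j * A i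

namespace IsFermionic

variable {a A : n → R} (h : IsFermionic a A)
include h

lemma number_mul_creation_sub (i : n) :
    (∑ j, a j * A j) * a i - a i * ∑ j, a j * A j = a i := by
  have key (j : n) : a j * A j * a i - a i * (a j * A j) = if j = i then a j else 0 := by
    rw [mul_assoc, h.annihilation_mul_creation, ← mul_assoc (a i), h.creation_mul_creation i j]
    split_ifs <;> noncomm_ring
  rw [Finset.sum_mul, Finset.mul_sum, ← Finset.sum_sub_distrib,
    Finset.sum_congr rfl fun j _ => key j]
  simp

lemma number_mul_annihilation_sub (i : n) :
    (∑ j, a j * A j) * A i - A i * ∑ j, a j * A j = -A i := by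
  have key (j : n) : a j * A j * A i - A i * (a j * A j) = if i = j then -A j else 0 := by
    rw [← mul_assoc (A i), h.annihilation_mul_creation, mul_assoc,
      h.annihilation_mul_annihilation j i]
    split_ifs <;> noncomm_ring
  rw [Finset.sum_mul, Finset.mul_sum, ← Finset.sum_sub_distrib,
    Finset.sum_congr rfl fun j _ => key j]
  simp

variable {m : Type*} [Fintype m] (e : m ⊕ m ≃ n)

lemma number_mul_raising_sub :
    (∑ j, a j * A j) * (∑ i, a (e (.inl i)) * a (e (.inr i))) -
      (∑ i, a (e (.inl i)) * a (e (.inr i))) * ∑ j, a j * A j =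
      2 • ∑ i, a (e (.inl i)) * a (e (.inr i)) := by
  have hN := h.number_mul_creation_sub
  generalize (∑ j, a j * A j) = N at *
  rw [Finset.sum_mul, Finset.mul_sum, ← Finset.sum_sub_distrib, Finset.smul_sum]
  refine Finset.sum_congr rfl fun i _ => ?_
  calc _ = (N * a (e (.inl i)) - a (e (.inl i)) * N) * a (e (.inr i)) +
        a (e (.inl i)) * (N * a (e (.inr i)) - a (e (.inr i)) * N) := by noncomm_ring
    _ = _ := by rw [hN, hN, two_smul]

lemma number_mul_lowering_sub :
    (∑ j, a j * A j) * (∑ i, A (e (.inr i)) * A (e (.inl i))) -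
      (∑ i, A (e (.inr i)) * A (e (.inl i))) * ∑ j, a j * A j =
      -(2 • ∑ i, A (e (.inr i)) * A (e (.inl i))) := by
  have hN := h.number_mul_annihilation_sub
  generalize (∑ j, a j * A j) = N at *
  rw [Finset.sum_mul, Finset.mul_sum, ← Finset.sum_sub_distrib, Finset.smul_sum,
    ← Finset.sum_neg_distrib]
  refine Finset.sum_congr rfl fun i _ => ?_
  calc _ = (N * A (e (.inr i)) - A (e (.inr i)) * N) * A (e (.inl i)) +
        A (e (.inr i)) * (N * A (e (.inl i)) - A (e (.inl i)) * N) := by noncomm_ring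
    _ = _ := by rw [hN, hN, two_smul, neg_mul, mul_neg, neg_add]

lemma raising_mul_lowering_sub :
    (∑ i, a (e (.inl i)) * a (e (.inr i))) * (∑ i, A (e (.inr i)) * A (e (.inl i))) -
      (∑ i, A (e (.inr i)) * A (e (.inl i))) * (∑ i, a (e (.inl i)) * a (e (.inr i))) =
      (∑ j, a j * A j) - (Fintype.card m : R) := by
  classical
  have key (i j : m) : a (e (.inl i)) * a (e (.inr i)) * (A (e (.inr j)) * A (e (.inl j))) -
      A (e (.inr j)) * A (e (.inl j)) * (a (e (.inl i)) * a (e (.inr i))) =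
      if i = j then a (e (.inl i)) * A (e (.inl i)) + a (e (.inr i)) * A (e (.inr i)) - 1
      else 0 := by
    split_ifs with hij
    · subst hij
      apply mul_sub_mul_of_anticommute <;> simp [h.annihilation_mul_creation]
    · apply mul_sub_mul_eq_zero_of_anticommute <;>
        simp [h.annihilation_mul_creation, Ne.symm hij]
  have hN : ∑ j, a j * A j =
      ∑ i : m, (a (e (.inl i)) * A (e (.inl i)) + a (e (.inr i)) * A (e (.inr i))) := by
    rw [← e.sum_comp, Fintype.sum_sum_type, Finset.sum_add_distrib]
  rw [Finset.sum_mul_sum, Finset.sum_mul_sum, Finset.sum_comm (s := Finset.univ (α := m)),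
    ← Finset.sum_sub_distrib, hN]
  simp_rw [← Finset.sum_sub_distrib, key]
  simp [Finset.sum_sub_distrib]

end IsFermionic

/-- If a number operator acts on a finite-dimensional space compatibly with canonical
anticommutation relations, the raising operator is injective below the middle degree. -/
lemma IsFermionic.eq_zero_of_raising_eq_zero {K V : Type*} [Field K] [CharZero K] [AddCommGroup V]
    [Module K V] [Module.Finite K V] {a A : n → Module.End K V} (h : IsFermionic a A)
    {m : Type*} [Fintype m] (e : m ⊕ m ≃ n) {k : ℕ} (hk : k < Fintype.card m) {x : V}
    (hx : (∑ j, a j * A j) x = (k : K) • x)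
    (hx' : (∑ i, a (e (.inl i)) * a (e (.inr i))) x = 0) : x = 0 := by
  by_contra hx0
  let _ : LieRing (Module.End K V) := .ofAssociativeRing
  have hH : ((∑ j, a j * A j) - (Fintype.card m : Module.End K V)) x =
      ((k : K) - Fintype.card m) • x := by
    rw [LinearMap.sub_apply, hx, sub_smul, Module.End.natCast_apply,
      Nat.cast_smul_eq_nsmul K (Fintype.card m)]
  have hμ : (k : K) - Fintype.card m ≠ 0 := sub_ne_zero.mpr (by exact_mod_cast hk.ne)
  have hcast (f : Module.End K V) : (Fintype.card m : Module.End K V) * f =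
      f * (Fintype.card m : Module.End K V) := Nat.cast_commute _ f
  have t : IsSl2Triple ((∑ j, a j * A j) - (Fintype.card m : Module.End K V))
      (∑ i, a (e (.inl i)) * a (e (.inr i))) (∑ i, A (e (.inr i)) * A (e (.inl i))) := by
    refine ⟨fun h0 => ?_, h.raising_mul_lowering_sub e, ?_, ?_⟩
    · rw [h0, LinearMap.zero_apply] at hH
      exact smul_ne_zero hμ hx0 hH.symm
    · rw [Ring.lie_def, sub_mul, mul_sub, hcast, sub_sub_sub_cancel_right,
        h.number_mul_raising_sub]
    · rw [Ring.lie_def, sub_mul, mul_sub, hcast, sub_sub_sub_cancel_right,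
        h.number_mul_lowering_sub]
  have P : t.HasPrimitiveVectorWith x ((k : K) - Fintype.card m) := ⟨hx0, hH, hx'⟩
  obtain ⟨r, hr⟩ := P.exists_nat
  rw [sub_eq_iff_eq_add] at hr
  have : k = r + Fintype.card m := by exact_mod_cast hr
  omega

end CanonicalAnticommutation

namespace ExteriorAlgebra

variable {K : Type*} [Field K] {n : Type*}

variable (K) in
/-- Left multiplication by the `i`-th standard basis vector. -/
noncomputable def creation [DecidableEq n] (i : n) : Module.End K (ExteriorAlgebra K (n → K)) :=
  LinearMap.mulLeft K (ι K (Pi.single i 1))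

variable (K) in
/-- Contraction with the `i`-th coordinate function. -/
noncomputable def annihilation (i : n) : Module.End K (ExteriorAlgebra K (n → K)) :=
  CliffordAlgebra.contractLeft (Q := (0 : QuadraticForm K (n → K)))
    (LinearMap.proj i : (n → K) →ₗ[K] K)

lemma ι_mul_ι_mul (v w : n → K) (x : ExteriorAlgebra K (n → K)) :
    ι K v * (ι K w * x) = -(ι K w * (ι K v * x)) := by
  rw [← mul_assoc, eq_neg_of_add_eq_zero_left (ι_add_mul_swap v w), neg_mul, mul_assoc]

lemma annihilation_ι_mul (i : n) (v : n → K) (x : ExteriorAlgebra K (n → K)) :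
    annihilation K i (ι K v * x) = v i • x - ι K v * annihilation K i x :=
  CliffordAlgebra.contractLeft_ι_mul _ _ _

variable [DecidableEq n]

lemma isFermionic : IsFermionic (creation K (n := n)) (annihilation K) where
  creation_mul_creation i j := LinearMap.ext fun x => ι_mul_ι_mul _ _ x
  annihilation_mul_annihilation i j := LinearMap.ext fun x =>
    CliffordAlgebra.contractLeft_comm (Q := (0 : QuadraticForm K (n → K))) _ _ x
  annihilation_mul_creation i j := by
    refine LinearMap.ext fun x => (annihilation_ι_mul i (Pi.single j 1) x).trans ?_
    rw [Pi.single_apply, LinearMap.sub_apply]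
    split_ifs
    · rw [one_smul]; rfl
    · rw [zero_smul]; rfl

variable [Fintype n]

lemma number_apply (x : ExteriorAlgebra K (n → K)) :
    (∑ i, creation K i * annihilation K i) x =
      ∑ i, ι K (Pi.single i 1) * annihilation K i x :=
  LinearMap.sum_apply _ _ _

lemma number_ι_mul (v : n → K) (x : ExteriorAlgebra K (n → K)) :
    (∑ i, creation K i * annihilation K i) (ι K v * x) =
      ι K v * x + ι K v * (∑ i, creation K i * annihilation K i) x := by
  have hv : ∑ i, v i • ι K (Pi.single i (1 : K)) = ι K v := by
    simp_rw [← map_smul, ← map_sum, ← Pi.single_smul, smul_eq_mul, mul_one,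
      Finset.univ_sum_single]
  have key (i : n) : ι K (Pi.single i (1 : K)) * annihilation K i (ι K v * x) =
      v i • ι K (Pi.single i 1) * x + ι K v * (ι K (Pi.single i 1) * annihilation K i x) := by
    rw [annihilation_ι_mul, mul_sub, ι_mul_ι_mul, sub_neg_eq_add, mul_smul_comm, smul_mul_assoc]
  rw [number_apply, number_apply, Finset.sum_congr rfl fun i _ => key i,
    Finset.sum_add_distrib, ← Finset.sum_mul, hv, Finset.mul_sum]

/-- The number operator acts on the `k`-th exterior power as multiplication by `k`. -/
lemma number_apply_of_mem {k : ℕ} {x : ExteriorAlgebra K (n → K)} (hx : x ∈ ⋀[K]^k (n → K)) :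
    (∑ i, creation K i * annihilation K i) x = (k : K) • x := by
  induction hx using Submodule.pow_induction_on_left' with
  | algebraMap r =>
    have (i : n) : annihilation K i (algebraMap K (ExteriorAlgebra K (n → K)) r) = 0 :=
      CliffordAlgebra.contractLeft_algebraMap _ _ _
    rw [number_apply]
    simp [this]
  | add x y k hx hy ihx ihy => rw [map_add, ihx, ihy, smul_add]
  | mem_mul m hm k x hx ih =>
    obtain ⟨v, rfl⟩ := hm
    rw [number_ι_mul, ih, mul_smul_comm, Nat.succ_eq_add_one, Nat.cast_add, Nat.cast_one,
      add_smul, one_smul, add_comm]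

instance moduleFinite : Module.Finite K (ExteriorAlgebra K (n → K)) :=
  let _ : LinearOrder n := LinearOrder.lift' (Fintype.equivFin n) (Fintype.equivFin n).injective
  .of_basis (Pi.basisFun K n).ExteriorAlgebra

end ExteriorAlgebra

/-- The pairing of the index `i` with the index `g + i`. -/
def finPairing (g : ℕ) : Fin g ⊕ Fin g ≃ Fin (2 * g) :=
  finSumFinEquiv.trans (finCongr (two_mul g).symm)

lemma sum_creation_mul_creation_apply (g : ℕ) (x : ExteriorAlgebra ℂ (Fin (2 * g) → ℂ)) :
    (∑ i, ExteriorAlgebra.creation ℂ (finPairing g (.inl i)) *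
      ExteriorAlgebra.creation ℂ (finPairing g (.inr i))) x = omegaBivector g * x := by
  rw [LinearMap.sum_apply, omegaBivector, Finset.sum_mul]
  exact Finset.sum_congr rfl fun i _ => (mul_assoc
    (ExteriorAlgebra.ι ℂ (Pi.single (finPairing g (.inl i)) 1))
    (ExteriorAlgebra.ι ℂ (Pi.single (finPairing g (.inr i)) 1)) x).symm

lemma omegaBivector_mem (g : ℕ) : omegaBivector g ∈ ⋀[ℂ]^2 (Fin (2 * g) → ℂ) := by
  refine Submodule.sum_mem _ fun i _ => ?_
  rw [ExteriorAlgebra.exteriorPower, pow_two]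
  exact Submodule.mul_mem_mul ⟨_, rfl⟩ ⟨_, rfl⟩

lemma finrank_omegaWedgeSubspace {g l : ℕ} (hl : 2 ≤ l) (hlg : l ≤ g) :
    Module.finrank ℂ (omegaWedgeSubspace g l) = (2 * g).choose (l - 2) := by
  have hle : Submodule.map (LinearMap.mulLeft ℂ (omegaBivector g))
      (⋀[ℂ]^(l - 2) (Fin (2 * g) → ℂ)) ≤ ⋀[ℂ]^l (Fin (2 * g) → ℂ) := by
    rintro _ ⟨y, hy, rfl⟩
    have := Submodule.mul_mem_mul (omegaBivector_mem g) hy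
    rwa [← pow_add, Nat.add_sub_cancel' hl] at this
  have hinj : Function.Injective ((LinearMap.mulLeft ℂ (omegaBivector g)).domRestrict
      (⋀[ℂ]^(l - 2) (Fin (2 * g) → ℂ))) := by
    rw [← LinearMap.ker_eq_bot, LinearMap.ker_eq_bot']
    rintro ⟨y, hy⟩ h
    exact Subtype.ext <| ExteriorAlgebra.isFermionic.eq_zero_of_raising_eq_zero (finPairing g)
      (k := l - 2) (by rw [Fintype.card_fin]; omega) (ExteriorAlgebra.number_apply_of_mem hy)
      ((sum_creation_mul_creation_apply g y).trans h)
  rw [omegaWedgeSubspace, (Submodule.comapSubtypeEquivOfLe hle).finrank_eq,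
    ← LinearMap.range_domRestrict, LinearMap.finrank_range_of_inj hinj, exteriorPower.finrank_eq,
    Module.finrank_fin_fun]

/-- Let `g ≥ 1` and `2 ≤ l ≤ g`.  The quotient space
`Λ^l ℂ^{2g} / (ω ∧ Λ^{l-2} ℂ^{2g})` has complex dimension
`(2g choose l) − (2g choose l−2)`. -/
theorem stmt_10 (g l : ℕ) (hg : 1 ≤ g) (hl : 2 ≤ l) (hlg : l ≤ g) :
    Module.finrank ℂ ((⋀[ℂ]^l (Fin (2 * g) → ℂ)) ⧸ omegaWedgeSubspace g l)
      = (2 * g).choose l - (2 * g).choose (l - 2) := by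
  rw [Submodule.finrank_quotient, finrank_omegaWedgeSubspace hl hlg, exteriorPower.finrank_eq,
    Module.finrank_fin_fun]
end
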